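/- Let k ∈ ℤ, m ∈ Sym_h(ℤ)∨ positive definite, and ν ∈ ℤ_{≥0}. For I ⊆ {1,…,h} let u_I ∈ GL_h(ℤ) be the diagonal matrix with i-th entry −1 if i ∈ I and 1 otherwise. If φ is a Jacobi form of weight k and index m with ord(φ) ≥ ν, then ψ(τ,z) := ∏_{I ⊆ {1,…,h}} φ(τ, u_I z) is a Jacobi form of weight 2^h k and index 2^h·diag(m₁₁,…,m_hh), with ord(ψ) ≥ 2^h ν. -/

import Mathlib

noncomputable section
open Matrix Complex
open scoped Manifold MatrixGroups

abbrev SL2Z := Matrix.SpecialLinearGroup (Fin 2) ℤ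
abbrev UHP := UpperHalfPlane

/-- `e(x) = exp(2 π i x)`. -/
def eC (x : ℂ) : ℂ := Complex.exp (2 * Real.pi * Complex.I * x)

/-- Coerce a rational matrix to a complex one. -/
def mC {h : ℕ} (m : Matrix (Fin h) (Fin h) ℚ) : Matrix (Fin h) (Fin h) ℂ :=
  m.map fun a => (a : ℂ)

def intVec {h : ℕ} (v : Fin h → ℤ) : Fin h → ℂ := fun i => (v i : ℂ)
def ratVec {h : ℕ} (v : Fin h → ℚ) : Fin h → ℂ := fun i => (v i : ℂ)

/-- `m ∈ Sym_h(ℤ)∨`: symmetric with integral diagonal and half-integral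
off-diagonal entries. -/
def IsJacobiIndex {h : ℕ} (m : Matrix (Fin h) (Fin h) ℚ) : Prop :=
  m.IsSymm ∧ (∀ i, ∃ n : ℤ, m i i = n) ∧ ∀ i j, ∃ n : ℤ, 2 * m i j = n

/-- weight-`k` index-`m` Jacobi slash action of `SL(2,ℤ)`. -/
def jslashSL {h : ℕ} (k : ℤ) (m : Matrix (Fin h) (Fin h) ℚ)
    (φ : UHP → (Fin h → ℂ) → ℂ) (γ : SL2Z) : UHP → (Fin h → ℂ) → ℂ := fun τ z =>
  let c : ℂ := ((γ 1 0 : ℤ) : ℂ)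
  let d : ℂ := ((γ 1 1 : ℤ) : ℂ)
  (c * (τ : ℂ) + d) ^ (-k) * eC (-(c * (z ⬝ᵥ mC m *ᵥ z)) * (c * (τ : ℂ) + d)⁻¹) *
    φ (γ • τ) ((c * (τ : ℂ) + d)⁻¹ • z)

/-- weight-`k` index-`m` Jacobi slash action of a (real) Heisenberg element
`(λ, μ, κ)`. -/
def jslashH {h : ℕ} (m : Matrix (Fin h) (Fin h) ℚ) (φ : UHP → (Fin h → ℂ) → ℂ)
    (lam mu : Fin h → ℂ) (kap : Matrix (Fin h) (Fin h) ℂ) : UHP → (Fin h → ℂ) → ℂ :=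
  fun τ z =>
    eC ((lam ⬝ᵥ mC m *ᵥ lam) * (τ : ℂ) + 2 * (lam ⬝ᵥ mC m *ᵥ z)
        + (mC m * (kap + vecMulVec mu lam)).trace) * φ τ (z + (τ : ℂ) • lam + mu)

/-- The block matrix `(2n, rᵀ; r, 2m)` over `ℝ`. -/
def bigMat {h : ℕ} (m : Matrix (Fin h) (Fin h) ℚ) (n : ℤ) (r : Fin h → ℤ) :
    Matrix (Unit ⊕ Fin h) (Unit ⊕ Fin h) ℝ :=
  Matrix.fromBlocks (Matrix.of fun _ _ => (2 * n : ℝ)) (Matrix.of fun _ j => (r j : ℝ))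
    (Matrix.of fun i _ => (r i : ℝ)) ((2 : ℝ) • m.map fun a => (a : ℝ))

/-- A weakly holomorphic Jacobi form of genus 1, cogenus `h`, weight `k` and
index `m`, bundled with its Fourier coefficients. -/
structure WeakJacobiForm (h : ℕ) (k : ℤ) (m : Matrix (Fin h) (Fin h) ℚ) where
  toFun : UHP → (Fin h → ℂ) → ℂ
  holo_tau : ∀ z, MDifferentiable 𝓘(ℂ) 𝓘(ℂ) fun τ : UHP => toFun τ z
  holo_z : ∀ τ, Differentiable ℂ fun z => toFun τ z
  inv_sl : ∀ γ : SL2Z, jslashSL k m toFun γ = toFun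
  inv_heis : ∀ (lam mu : Fin h → ℤ) (kap : Matrix (Fin h) (Fin h) ℤ),
    ((kap.map fun a => (a : ℚ)) +
      vecMulVec (fun i => (mu i : ℚ)) fun i => (lam i : ℚ)).IsSymm →
    jslashH m toFun (intVec lam) (intVec mu) (kap.map fun a => (a : ℂ)) = toFun
  coeff : ℤ → (Fin h → ℤ) → ℂ
  expansion : ∀ τ z, toFun τ z =
    ∑' p : ℤ × (Fin h → ℤ), coeff p.1 p.2 * eC ((p.1 : ℂ) * (τ : ℂ) + intVec p.2 ⬝ᵥ z)
  bdd_below : ∃ n₀ : ℤ, ∀ n r, n < n₀ → coeff n r = 0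

/-- The Fourier support condition singling out holomorphic Jacobi forms among
weakly holomorphic ones. -/
def WeakJacobiForm.IsHolomorphicJF {h : ℕ} {k : ℤ} {m : Matrix (Fin h) (Fin h) ℚ}
    (φ : WeakJacobiForm h k m) : Prop :=
  ∀ n r, ¬ (bigMat m n r).PosSemidef → φ.coeff n r = 0

/-- Specialization `φ[α,β]` of a Jacobi form to the torsion point `z = ατ + β`. -/
def torsionSpec {h : ℕ} (m : Matrix (Fin h) (Fin h) ℚ) (φ : UHP → (Fin h → ℂ) → ℂ)
    (α β : Fin h → ℚ) : UHP → ℂ :=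
  fun τ => jslashH m φ (ratVec α) (ratVec β) (vecMulVec (ratVec α) (ratVec β)) τ 0

/-- `OrdGE f c` formalizes that the vanishing order of `f` at `i∞` is at least
`c`: the function `f(τ) e(-cτ)` is bounded on `im τ ≥ 1`. -/
def OrdGE (f : UHP → ℂ) (c : ℝ) : Prop :=
  ∃ C : ℝ, ∀ τ : UHP, 1 ≤ τ.im → ‖f τ * Complex.exp (-(2 * Real.pi * Complex.I * c * (τ : ℂ)))‖ ≤ C

/-- The weight-`k` slash action on functions on the upper half plane. -/
def eslash (k : ℤ) (f : UHP → ℂ) (γ : SL2Z) : UHP → ℂ := fun τ =>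
  (((γ 1 0 : ℤ) : ℂ) * (τ : ℂ) + ((γ 1 1 : ℤ) : ℂ)) ^ (-k) * f (γ • τ)

/-- The monomial attached to an exponent. -/
def chiJ {h : ℕ} (τ : UHP) (z : Fin h → ℂ) (p : ℤ × (Fin h → ℤ)) : ℂ :=
  eC ((p.1 : ℂ) * (τ : ℂ) + intVec p.2 ⬝ᵥ z)

structure GoodJ {h : ℕ} (k : ℤ) (m : Matrix (Fin h) (Fin h) ℚ) (N : ℤ)
    (f : UHP → (Fin h → ℂ) → ℂ) : Prop where
  holo_tau : ∀ z, MDifferentiable 𝓘(ℂ) 𝓘(ℂ) fun τ : UHP => f τ z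
  holo_z : ∀ τ, Differentiable ℂ fun z => f τ z
  inv_sl : ∀ γ : SL2Z, jslashSL k m f γ = f
  inv_heis : ∀ (lam mu : Fin h → ℤ) (kap : Matrix (Fin h) (Fin h) ℤ),
    ((kap.map fun a => (a : ℚ)) +
      vecMulVec (fun i => (mu i : ℚ)) fun i => (lam i : ℚ)).IsSymm →
    jslashH m f (intVec lam) (intVec mu) (kap.map fun a => (a : ℂ)) = f
  four : ∃ C : ℤ × (Fin h → ℤ) → ℂ,
    (∀ τ z, Summable fun p => C p * chiJ τ z p) ∧
    (∀ τ z, f τ z = ∑' p, C p * chiJ τ z p) ∧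
    (∀ p, C p ≠ 0 → (bigMat m p.1 p.2).PosSemidef ∧ N ≤ p.1)

lemma eC_add (a b : ℂ) : eC (a + b) = eC a * eC b := by
  simp only [eC, mul_add, Complex.exp_add]

lemma eC_zero : eC 0 = 1 := by simp [eC]

lemma chiJ_add {h : ℕ} (τ : UHP) (z : Fin h → ℂ) (p q : ℤ × (Fin h → ℤ)) :
    chiJ τ z (p + q) = chiJ τ z p * chiJ τ z q := by
  unfold chiJ
  rw [← eC_add]
  congr 1
  simp only [dotProduct, intVec, Prod.fst_add, Prod.snd_add, Pi.add_apply, Int.cast_add, add_mul,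
    Finset.sum_add_distrib]
  ring

lemma denom_ne (γ : SL2Z) (τ : UHP) :
    (((γ 1 0 : ℤ) : ℂ) * (τ : ℂ) + ((γ 1 1 : ℤ) : ℂ)) ≠ 0 := by
  have := UpperHalfPlane.denom_ne_zero (γ : GL (Fin 2) ℝ) τ
  simpa [UpperHalfPlane.denom] using this

lemma mC_add {h : ℕ} (m₁ m₂ : Matrix (Fin h) (Fin h) ℚ) : mC (m₁ + m₂) = mC m₁ + mC m₂ := by
  ext i j; simp [mC]

lemma bigMat_add {h : ℕ} (m₁ m₂ : Matrix (Fin h) (Fin h) ℚ) (n₁ n₂ : ℤ) (r₁ r₂ : Fin h → ℤ) :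
    bigMat (m₁ + m₂) (n₁ + n₂) (r₁ + r₂) = bigMat m₁ n₁ r₁ + bigMat m₂ n₂ r₂ := by
  ext (i | i) (j | j) <;> simp [bigMat] <;> ring

lemma four_mul {h : ℕ} (C D : ℤ × (Fin h → ℤ) → ℂ) (τ : UHP) (z : Fin h → ℂ)
    (hC : Summable fun p => C p * chiJ τ z p) (hD : Summable fun p => D p * chiJ τ z p) :
    (Summable fun s => (∑' q, C (s - q) * D q) * chiJ τ z s) ∧
    (∑' p, C p * chiJ τ z p) * (∑' p, D p * chiJ τ z p) =
      ∑' s, (∑' q, C (s - q) * D q) * chiJ τ z s := by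
  let G := ℤ × (Fin h → ℤ)
  let σ : G × G ≃ G × G :=
    { toFun := fun x => (x.1 - x.2, x.2)
      invFun := fun x => (x.1 + x.2, x.2)
      left_inv := fun x => by simp
      right_inv := fun x => by simp }
  have hs := summable_mul_of_summable_norm hC.norm hD.norm
  have hs' := (σ.summable_iff).2 hs
  have key : ∀ s q : G, (C (s - q) * chiJ τ z (s - q)) * (D q * chiJ τ z q)
      = (C (s - q) * D q) * chiJ τ z s := by
    intro s q
    have : chiJ τ z s = chiJ τ z (s - q) * chiJ τ z q := by rw [← chiJ_add, sub_add_cancel]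
    rw [this]; ring
  have e1 : ∀ s : G, ∑' q, ((fun x : G × G => (C x.1 * chiJ τ z x.1) * (D x.2 * chiJ τ z x.2)) ∘ σ) (s, q)
      = (∑' q, C (s - q) * D q) * chiJ τ z s := by
    intro s
    rw [← tsum_mul_right]
    exact tsum_congr fun q => key s q
  refine ⟨?_, ?_⟩
  · have := hs'.prod
    exact this.congr fun s => e1 s
  · rw [tsum_mul_tsum_of_summable_norm hC.norm hD.norm, ← σ.tsum_eq]
    rw [← tsum_congr e1]
    exact hs'.tsum_prod

lemma GoodJ.mul {h : ℕ} {k₁ k₂ : ℤ} {m₁ m₂ : Matrix (Fin h) (Fin h) ℚ} {N₁ N₂ : ℤ}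
    {f g : UHP → (Fin h → ℂ) → ℂ} (hf : GoodJ k₁ m₁ N₁ f) (hg : GoodJ k₂ m₂ N₂ g) :
    GoodJ (k₁ + k₂) (m₁ + m₂) (N₁ + N₂) (fun τ z => f τ z * g τ z) where
  holo_tau z := (hf.holo_tau z).mul (hg.holo_tau z)
  holo_z τ := (hf.holo_z τ).mul (hg.holo_z τ)
  inv_sl γ := by
    funext τ z
    have h1 := congrFun (congrFun (hf.inv_sl γ) τ) z
    have h2 := congrFun (congrFun (hg.inv_sl γ) τ) z
    rw [← h1, ← h2]
    simp only [jslashSL, mC_add, neg_add, zpow_add₀ (denom_ne γ τ), add_mulVec, dotProduct_add,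
      mul_add, add_mul, eC_add]
    ring
  inv_heis lam mu kap hk := by
    funext τ z
    have h1 := congrFun (congrFun (hf.inv_heis lam mu kap hk) τ) z
    have h2 := congrFun (congrFun (hg.inv_heis lam mu kap hk) τ) z
    rw [← h1, ← h2]
    simp only [jslashH, mC_add, add_mulVec, dotProduct_add, Matrix.add_mul, Matrix.trace_add,
      mul_add, add_mul, eC_add]
    ring
  four := by
    obtain ⟨C, hC, hfC, sC⟩ := hf.four
    obtain ⟨D, hD, hgD, sD⟩ := hg.four
    refine ⟨fun s => ∑' q, C (s - q) * D q, fun τ z => (four_mul C D τ z (hC τ z) (hD τ z)).1,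
      fun τ z => ?_, fun s hs => ?_⟩
    · rw [hfC, hgD]; exact (four_mul C D τ z (hC τ z) (hD τ z)).2
    · obtain ⟨q, hq⟩ : ∃ q, C (s - q) * D q ≠ 0 := by
        by_contra hcon
        push Not at hcon
        exact hs (by simp [hcon])
      obtain ⟨a1, a2⟩ := sC _ (left_ne_zero_of_mul hq)
      obtain ⟨b1, b2⟩ := sD _ (right_ne_zero_of_mul hq)
      constructor
      · have := a1.add b1
        rw [← bigMat_add] at this
        simpa using this
      · simp at a2; omega

lemma GoodJ.one {h : ℕ} : GoodJ (h := h) 0 0 0 (fun _ _ => 1) where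
  holo_tau z := mdifferentiable_const
  holo_z τ := differentiable_const _
  inv_sl γ := by
    funext τ z
    have : mC (0 : Matrix (Fin h) (Fin h) ℚ) = 0 := by ext; simp [mC]
    simp [jslashSL, this, eC]
  inv_heis lam mu kap hk := by
    funext τ z
    have : mC (0 : Matrix (Fin h) (Fin h) ℚ) = 0 := by ext; simp [mC]
    simp [jslashH, this, eC]
  four := by
    classical
    have h0 : ∀ τ z, chiJ (h := h) τ z 0 = 1 := by
      intro τ z; simp [chiJ, eC, intVec, dotProduct]
    refine ⟨fun p => if p = 0 then 1 else 0, fun τ z => ?_, fun τ z => ?_, fun p hp => ?_⟩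
    · apply summable_of_ne_finset_zero (s := {0})
      intro b hb
      simp at hb
      simp [hb]
    · rw [tsum_eq_single 0]
      · simp [h0]
      · intro b hb; simp [hb]
    · have : p = 0 := by by_contra hh; simp [hh] at hp
      subst this
      have : bigMat (0 : Matrix (Fin h) (Fin h) ℚ) 0 0 = 0 := by
        ext (i | i) (j | j) <;> simp [bigMat]
      simp only [Prod.fst_zero, Prod.snd_zero, this]
      exact ⟨Matrix.PosSemidef.zero, le_refl _⟩

lemma GoodJ.prod {h : ℕ} {ι : Type} (S : Finset ι) {k : ι → ℤ} {m : ι → Matrix (Fin h) (Fin h) ℚ}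
    {N : ι → ℤ} {f : ι → UHP → (Fin h → ℂ) → ℂ} (hf : ∀ i, GoodJ (k i) (m i) (N i) (f i)) :
    GoodJ (∑ i ∈ S, k i) (∑ i ∈ S, m i) (∑ i ∈ S, N i) (fun τ z => ∏ i ∈ S, f i τ z) := by
  classical
  induction S using Finset.induction_on with
  | empty => simpa using GoodJ.one
  | insert a S ha ih =>
    simp only [Finset.sum_insert ha, Finset.prod_insert ha]
    exact (hf a).mul ih

/-- sign-changed index -/
def sgnM {h : ℕ} (e : Fin h → ℤ) (m : Matrix (Fin h) (Fin h) ℚ) : Matrix (Fin h) (Fin h) ℚ :=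
  Matrix.of fun i j => (e i : ℚ) * m i j * (e j : ℚ)

lemma sgn_quad {h : ℕ} (e : Fin h → ℤ) (m : Matrix (Fin h) (Fin h) ℚ) (x y : Fin h → ℂ) :
    x ⬝ᵥ mC (sgnM e m) *ᵥ y = (fun i => (e i : ℂ) * x i) ⬝ᵥ mC m *ᵥ (fun i => (e i : ℂ) * y i) := by
  simp only [dotProduct, mulVec, mC, sgnM, Matrix.map_apply, Matrix.of_apply, Finset.mul_sum]
  refine Finset.sum_congr rfl fun i _ => Finset.sum_congr rfl fun j _ => ?_
  push_cast
  ring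

lemma sgn_trace {h : ℕ} (e : Fin h → ℤ) (m : Matrix (Fin h) (Fin h) ℚ)
    (K : Matrix (Fin h) (Fin h) ℂ) :
    (mC (sgnM e m) * K).trace = (mC m * Matrix.of fun i j => (e i : ℂ) * K i j * e j).trace := by
  simp only [Matrix.trace, Matrix.diag, Matrix.mul_apply, mC, sgnM, Matrix.map_apply,
    Matrix.of_apply]
  refine Finset.sum_congr rfl fun i _ => Finset.sum_congr rfl fun j _ => ?_
  push_cast
  ring

lemma bigMat_sgn {h : ℕ} (e : Fin h → ℤ) (m : Matrix (Fin h) (Fin h) ℚ) (n : ℤ) (r : Fin h → ℤ)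
    (hp : (bigMat m n r).PosSemidef) : (bigMat (sgnM e m) n (e * r)).PosSemidef := by
  let d : Unit ⊕ Fin h → ℝ := Sum.elim (fun _ => 1) (fun i => (e i : ℝ))
  have := hp.conjTranspose_mul_mul_same (Matrix.diagonal d)
  convert this using 1
  ext (i | i) (j | j) <;> simp [bigMat, sgnM, d, Matrix.diagonal_conjTranspose] <;> ring

lemma GoodJ.sgn {h : ℕ} {k : ℤ} {m : Matrix (Fin h) (Fin h) ℚ} {N : ℤ}
    {f : UHP → (Fin h → ℂ) → ℂ} (hf : GoodJ k m N f) (e : Fin h → ℤ) (he : ∀ i, e i * e i = 1) :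
    GoodJ k (sgnM e m) N (fun τ z => f τ (fun i => (e i : ℂ) * z i)) where
  holo_tau z := hf.holo_tau _
  holo_z τ := (hf.holo_z τ).comp (by fun_prop)
  inv_sl γ := by
    funext τ z
    have h1 := congrFun (congrFun (hf.inv_sl γ) τ) (fun i => (e i : ℂ) * z i)
    rw [← h1]
    simp only [jslashSL, sgn_quad]
    congr 2
    funext i
    simp only [Pi.smul_apply, smul_eq_mul]
    ring
  inv_heis lam mu kap hk := by
    funext τ z
    have h1 := congrFun (congrFun (hf.inv_heis (e * lam) (e * mu)
      (Matrix.of fun i j => e i * kap i j * e j) ?_) τ) (fun i => (e i : ℂ) * z i)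
    · rw [← h1]
      have hl : ∀ v : Fin h → ℤ, intVec (e * v) = fun i => (e i : ℂ) * intVec v i := by
        intro v; funext i; simp [intVec]
      have ht : ((Matrix.of fun i j => e i * kap i j * e j).map fun a => (a : ℂ)) +
          vecMulVec (intVec (e * mu)) (intVec (e * lam)) =
          Matrix.of fun i j => (e i : ℂ) *
            ((kap.map fun a => (a : ℂ)) + vecMulVec (intVec mu) (intVec lam)) i j * e j := by
        ext i j
        simp [vecMulVec, intVec]
        ring
      have hz : (fun i => (e i : ℂ) * (z + (τ : ℂ) • intVec lam + intVec mu) i) =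
          (fun i => (e i : ℂ) * z i) + (τ : ℂ) • intVec (e * lam) + intVec (e * mu) := by
        funext i
        simp [intVec]
        ring
      simp only [jslashH, sgn_quad, sgn_trace, ht, hz]
      simp only [hl]
    · ext i j
      have := congrFun (congrFun hk i) j
      simp [vecMulVec] at this ⊢
      linear_combination (e i : ℚ) * (e j : ℚ) * this
  four := by
    obtain ⟨C, hC, hfC, sC⟩ := hf.four
    have hee : e * e = 1 := funext he
    let σ : ℤ × (Fin h → ℤ) ≃ ℤ × (Fin h → ℤ) :=
      { toFun := fun p => (p.1, e * p.2)
        invFun := fun p => (p.1, e * p.2)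
        left_inv := fun p => by simp [← mul_assoc, hee]
        right_inv := fun p => by simp [← mul_assoc, hee] }
    have hchi : ∀ τ z p, chiJ τ z p = chiJ τ (fun i => (e i : ℂ) * z i) (σ p) := by
      intro τ z p
      simp only [chiJ, σ, Equiv.coe_fn_mk]
      congr 2
      simp only [dotProduct, intVec, Pi.mul_apply]
      refine Finset.sum_congr rfl fun i _ => ?_
      have : (e i : ℂ) * e i = 1 := by exact_mod_cast he i
      push_cast
      linear_combination (-(p.2 i : ℂ) * z i) * this
    refine ⟨fun p => C (σ p), fun τ z => ?_, fun τ z => ?_, fun p hp => ?_⟩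
    · exact ((σ.summable_iff).2 (hC τ (fun i => (e i : ℂ) * z i))).congr
        fun p => by rw [hchi τ z p]; rfl
    · rw [hfC, ← σ.tsum_eq (fun p => C p * chiJ τ (fun i => (e i : ℂ) * z i) p)]
      exact tsum_congr fun p => by rw [hchi τ z p]
    · obtain ⟨a, b⟩ := sC _ hp
      refine ⟨?_, b⟩
      have := bigMat_sgn e m _ _ a
      simpa [σ, ← mul_assoc, hee] using this

lemma norm_chiJ {h : ℕ} (τ : UHP) (z : Fin h → ℂ) (p : ℤ × (Fin h → ℤ)) :
    ‖chiJ τ z p‖ = Real.exp (-(2 * Real.pi * (p.1 * τ.im + ∑ i, (p.2 i : ℝ) * (z i).im))) := by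
  rw [chiJ, eC, Complex.norm_exp]
  congr 1
  have : ((p.1 : ℂ) * (τ : ℂ) + intVec p.2 ⬝ᵥ z).im = p.1 * τ.im + ∑ i, (p.2 i : ℝ) * (z i).im := by
    simp [dotProduct, intVec, Complex.im_sum]
  rw [← this]
  simp

lemma psd_bound {h : ℕ} {m : Matrix (Fin h) (Fin h) ℚ} {n : ℤ} {r : Fin h → ℤ}
    (hp : (bigMat m n r).PosSemidef) (i : Fin h) (s t : ℝ) :
    0 ≤ n * s ^ 2 + r i * s * t + (m i i : ℝ) * t ^ 2 := by
  have := hp.dotProduct_mulVec_nonneg (Sum.elim (fun _ => s) (Pi.single i t))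
  simp [bigMat, Matrix.fromBlocks_mulVec, dotProduct, mulVec, Pi.single_apply, Fintype.sum_sum_type] at this
  nlinarith

lemma psd_nonneg {h : ℕ} {m : Matrix (Fin h) (Fin h) ℚ} {n : ℤ} {r : Fin h → ℤ}
    (hp : (bigMat m n r).PosSemidef) : (0 : ℝ) ≤ n := by
  have := hp.diag_nonneg (i := Sum.inl ())
  simp [bigMat] at this
  exact_mod_cast this

lemma growth {h : ℕ} (m : Matrix (Fin h) (Fin h) ℚ) (δ : ℝ) (hδ : 0 < δ) (w : Fin h → ℝ) :
    ∃ K : ℝ, ∀ (n : ℤ) (r : Fin h → ℤ), (bigMat m n r).PosSemidef →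
      -(n * δ + ∑ i, (r i : ℝ) * w i) ≤ K := by
  set s : ℝ := Real.sqrt (δ / (h + 1)) with hs
  have hs0 : 0 < s := Real.sqrt_pos.2 (by positivity)
  have hs2 : s ^ 2 = δ / (h + 1) := Real.sq_sqrt (by positivity)
  refine ⟨∑ i, (m i i : ℝ) * (w i / s) ^ 2, fun n r hp => ?_⟩
  have h1 : ∀ i ∈ Finset.univ, -((n : ℝ) * s ^ 2 + r i * w i) ≤ (m i i : ℝ) * (w i / s) ^ 2 := by
    intro i _
    have := psd_bound hp i s (w i / s)
    have e : (r i : ℝ) * s * (w i / s) = r i * w i := by field_simp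
    rw [e] at this
    linarith
  have h2 := Finset.sum_le_sum h1
  rw [Finset.sum_neg_distrib, Finset.sum_add_distrib] at h2
  simp only [Finset.sum_const, Finset.card_univ, Fintype.card_fin, nsmul_eq_mul, hs2] at h2
  have h3 : (h : ℝ) * (n * (δ / (h + 1))) ≤ n * δ := by
    have hn := psd_nonneg hp
    have : (n : ℝ) * δ - (h : ℝ) * (n * (δ / (h + 1))) = n * δ / (h + 1) := by field_simp; ring
    have : 0 ≤ (n : ℝ) * δ / (h + 1) := by positivity
    linarith
  linarith

lemma summ_up {h : ℕ} (m : Matrix (Fin h) (Fin h) ℚ) (C : ℤ × (Fin h → ℤ) → ℂ)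
    (hC : ∀ p, C p ≠ 0 → (bigMat m p.1 p.2).PosSemidef) (τ₀ τ : UHP) (z₀ z : Fin h → ℂ)
    (hlt : τ₀.im < τ.im) (hs : Summable fun p => C p * chiJ τ₀ z₀ p) :
    Summable fun p => C p * chiJ τ z p := by
  obtain ⟨K, hK⟩ := growth m (τ.im - τ₀.im) (sub_pos.2 hlt) (fun i => (z i).im - (z₀ i).im)
  refine Summable.of_norm_bounded (hs.norm.mul_left (Real.exp (2 * Real.pi * K))) fun p => ?_
  by_cases hp : C p = 0
  · simp [hp]
  · have := hK _ _ (hC p hp)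
    rw [norm_mul, norm_mul, norm_chiJ, norm_chiJ, mul_left_comm, ← Real.exp_add]
    gcongr
    simp only [mul_sub, Finset.sum_sub_distrib] at this
    nlinarith [Real.pi_pos]

lemma zero_of_low (f : UHP → ℂ) (hf : MDifferentiable 𝓘(ℂ) 𝓘(ℂ) f) (y : ℝ) (hy : 0 < y)
    (h0 : ∀ τ : UHP, τ.im < y → f τ = 0) (τ : UHP) : f τ = 0 := by
  have hd := UpperHalfPlane.mdifferentiable_iff.1 hf
  have ha := hd.analyticOnNhd UpperHalfPlane.isOpen_upperHalfPlaneSet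
  have hpre : IsPreconnected UpperHalfPlane.upperHalfPlaneSet :=
    (convex_halfSpace_im_gt 0).isPreconnected
  have hz : (((y / 2 : ℝ) : ℂ) * Complex.I) ∈ UpperHalfPlane.upperHalfPlaneSet := by
    simp [UpperHalfPlane.upperHalfPlaneSet]; linarith
  have := ha.eqOn_zero_of_preconnected_of_eventuallyEq_zero hpre hz ?_
  · have h2 := this τ.im_pos
    simpa using h2
  · have hU : IsOpen {w : ℂ | 0 < w.im ∧ w.im < y} :=
      (isOpen_lt continuous_const Complex.continuous_im).inter
        (isOpen_lt Complex.continuous_im continuous_const)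
    refine Filter.eventually_of_mem (hU.mem_nhds ?_) ?_
    · constructor <;> simp <;> linarith
    · rintro w ⟨hw, hw2⟩
      simp only [Function.comp, Pi.zero_apply]
      apply h0
      rw [UpperHalfPlane.ofComplex_apply_of_im_pos hw]
      exact hw2

lemma good_of_form {h : ℕ} {k : ℤ} {m : Matrix (Fin h) (Fin h) ℚ} {ν : ℤ}
    (φ : WeakJacobiForm h k m)
    (hφ : φ.IsHolomorphicJF) (hord : ∀ n r, n < ν → φ.coeff n r = 0) :
    GoodJ k m ν φ.toFun where
  holo_tau := φ.holo_tau
  holo_z := φ.holo_z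
  inv_sl := φ.inv_sl
  inv_heis := φ.inv_heis
  four := by
    have hpsd : ∀ p : ℤ × (Fin h → ℤ), φ.coeff p.1 p.2 ≠ 0 → (bigMat m p.1 p.2).PosSemidef := by
      intro p hp
      by_contra hh
      exact hp (hφ _ _ hh)
    by_cases hall : ∀ τ z, Summable fun p : ℤ × (Fin h → ℤ) => φ.coeff p.1 p.2 * chiJ τ z p
    · refine ⟨fun p => φ.coeff p.1 p.2, hall, φ.expansion, fun p hp => ⟨hpsd p hp, ?_⟩⟩
      by_contra hh
      exact hp (hord _ _ (not_le.1 hh))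
    · push Not at hall
      obtain ⟨τ₁, z₁, hns⟩ := hall
      have hzero : ∀ z τ, φ.toFun τ z = 0 := by
        intro z
        refine zero_of_low (fun τ => φ.toFun τ z) (φ.holo_tau z) τ₁.im τ₁.im_pos fun τ hτ => ?_
        refine (φ.expansion τ z).trans (tsum_eq_zero_of_not_summable fun hs => hns ?_)
        exact summ_up m (fun p => φ.coeff p.1 p.2) hpsd τ τ₁ z z₁ hτ hs
      exact ⟨fun _ => 0, by simp [summable_zero], by simp [hzero], by simp⟩

/-- the sign vector of `I` -/
def sg {h : ℕ} (I : Finset (Fin h)) (i : Fin h) : ℤ := if i ∈ I then -1 else 1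

lemma sg_mul_self {h : ℕ} (I : Finset (Fin h)) (i : Fin h) : sg I i * sg I i = 1 := by
  unfold sg; split_ifs <;> simp

lemma sum_sg {h : ℕ} (m : Matrix (Fin h) (Fin h) ℚ) :
    ∑ I : Finset (Fin h), sgnM (sg I) m = (2 ^ h : ℚ) • Matrix.diagonal fun i => m i i := by
  ext i j
  rw [Matrix.sum_apply]
  by_cases hij : i = j
  · subst hij
    have : ∀ I : Finset (Fin h), sgnM (sg I) m i i = m i i := by
      intro I
      have : (sg I i : ℚ) * sg I i = 1 := by exact_mod_cast sg_mul_self I i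
      simp only [sgnM, Matrix.of_apply]
      linear_combination (m i i) * this
    simp [this]
  · simp only [Matrix.smul_apply, Matrix.diagonal_apply_ne _ hij, smul_zero]
    refine Finset.sum_involution (fun I _ => symmDiff I {i}) ?_ ?_ ?_ ?_
    · intro I _
      have hj : j ≠ i := fun h => hij h.symm
      by_cases h1 : i ∈ I <;> simp [sgnM, sg, Finset.mem_symmDiff, h1, hj] <;> split_ifs <;> ring
    · intro I _ _ hI
      have := congrArg (fun S => i ∈ S) hI
      simp [Finset.mem_symmDiff] at this
    · intro I _; exact Finset.mem_univ _
    · intro I _; simp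

/-- If `φ` is a holomorphic Jacobi form of weight `k`, positive definite index
`m` and vanishing order at least `ν ≥ 0`, then
`ψ(τ,z) = ∏_{I ⊆ {1,…,h}} φ(τ, u_I z)` is a holomorphic Jacobi form of weight
`2^h k` and index `2^h·diag(m₁₁,…,m_hh)` with vanishing order at least
`2^h ν`. -/
theorem stmt19 (h : ℕ) (k : ℤ) (m : Matrix (Fin h) (Fin h) ℚ)
    (hm : IsJacobiIndex m) (hpd : (m.map fun a => (a : ℝ)).PosDef)
    (ν : ℤ) (hν0 : 0 ≤ ν) (φ : WeakJacobiForm h k m)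
    (hφ : φ.IsHolomorphicJF) (hord : ∀ n r, n < ν → φ.coeff n r = 0) :
    ∃ Ψ : WeakJacobiForm h ((2 ^ h : ℤ) * k)
        ((2 ^ h : ℚ) • Matrix.diagonal fun i => m i i),
      Ψ.IsHolomorphicJF ∧
      (∀ τ z, Ψ.toFun τ z =
        ∏ I : Finset (Fin h), φ.toFun τ fun i => if i ∈ I then -z i else z i) ∧
      (∀ n r, n < (2 ^ h : ℤ) * ν → Ψ.coeff n r = 0) := by
  have hg := good_of_form φ hφ hord
  have hp := GoodJ.prod Finset.univ (fun I : Finset (Fin h) => hg.sgn (sg I) (sg_mul_self I))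
  rw [sum_sg] at hp
  have hc : ∀ x : ℤ, ∑ _I : Finset (Fin h), x = 2 ^ h * x := by intro x; simp
  rw [hc, hc] at hp
  obtain ⟨C, -, hf, hs⟩ := hp.four
  have hv : ∀ n r, n < (2 ^ h : ℤ) * ν → C (n, r) = 0 := by
    intro n r hn
    by_contra hh
    have := (hs _ hh).2
    simp only at this
    omega
  refine ⟨⟨_, hp.holo_tau, hp.holo_z, hp.inv_sl, hp.inv_heis, fun n r => C (n, r), hf,
    ⟨_, hv⟩⟩, ?_, ?_, hv⟩
  · intro n r hn
    by_contra hh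
    exact hn (hs _ hh).1
  · intro τ z
    change (∏ I : Finset (Fin h), φ.toFun τ fun i => (sg I i : ℂ) * z i) = _
    refine Finset.prod_congr rfl fun I _ => ?_
    congr 1
    funext i
    by_cases hi : i ∈ I <;> simp [sg, hi]
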